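/- arXiv:1712.07330 — 3 statements merged into one kernel-verified Lean document; each statement's English description precedes it below -/
import Mathlib

section
/- The map n(t) := R_{−η(t)+π/2}·U(t)/‖U(t)‖ is a C^∞ map n : ℝ → ℝ² satisfying ‖n(t)‖ = 1 and ⟨γ'(t), n(t)⟩ = 0 for all t ∈ ℝ. In particular, the curve γ = (x, y) is a frontal at every point. -/
open Real

/-- Rotation of the plane by angle `θ`. -/
noncomputable def rot (θ : ℝ) (v : ℝ × ℝ) : ℝ × ℝ :=
  (Real.cos θ * v.1 - Real.sin θ * v.2, Real.sin θ * v.1 + Real.cos θ * v.2)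

/-- Determinant of the 2×2 matrix with columns `v`, `w`. -/
def det2 (v w : ℝ × ℝ) : ℝ := v.1 * w.2 - v.2 * w.1

theorem hasDerivAt_of_eq_integral {f g : ℝ → ℝ} (hf : Continuous f)
    (hg : ∀ t, g t = ∫ u in (0:ℝ)..t, f u) (t : ℝ) : HasDerivAt g (f t) t := by
  rw [funext hg]
  exact hf.integral_hasStrictDerivAt 0 t |>.hasDerivAt

theorem contDiff_top_of_eq_integral {f g : ℝ → ℝ} (hf : ContDiff ℝ (⊤ : ℕ∞) f)
    (hg : ∀ t, g t = ∫ u in (0:ℝ)..t, f u) : ContDiff ℝ (⊤ : ℕ∞) g := by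
  have hd := hasDerivAt_of_eq_integral hf.continuous hg
  refine contDiff_infty_iff_deriv.2 ⟨fun t => (hd t).differentiableAt, ?_⟩
  rwa [funext fun t => (hd t).deriv]

/-- The map `n = R_{−η+π/2} U / ‖U‖` is a smooth unit normal along `γ`;
in particular `γ` is a frontal at every point. -/
theorem profile_curve_is_frontal
    (l h : ℝ → ℝ) (hl : ContDiff ℝ (⊤ : ℕ∞) l) (hh : ContDiff ℝ (⊤ : ℕ∞) h)
    (η F G : ℝ → ℝ)
    (hη : ∀ u, η u = ∫ v in (0:ℝ)..u, 2 * h v)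
    (hF : ∀ t, F t = ∫ u in (0:ℝ)..t, l u * sin (η u))
    (hG : ∀ t, G t = ∫ u in (0:ℝ)..t, l u * cos (η u))
    (c₁ c₂ : ℝ)
    (hpos : ∀ t, 0 < (F t - c₁) ^ 2 + (G t - c₂) ^ 2)
    (y x : ℝ → ℝ)
    (hy : ∀ t, y t = Real.sqrt ((F t - c₁) ^ 2 + (G t - c₂) ^ 2))
    (hx : ∀ t, x t = ∫ u in (0:ℝ)..t,
      (deriv F u * (G u - c₂) - deriv G u * (F u - c₁)) / y u)
    (γ : ℝ → ℝ × ℝ) (hγ : ∀ t, γ t = (x t, y t))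
    (U : ℝ → ℝ × ℝ) (hU : ∀ t, U t = (-(F t - c₁), G t - c₂))
    (n : ℝ → ℝ × ℝ)
    (hn : ∀ t, n t = (1 / Real.sqrt ((U t).1 ^ 2 + (U t).2 ^ 2)) •
      rot (-(η t) + Real.pi / 2) (U t))
    :
    ContDiff ℝ (⊤ : ℕ∞) n ∧
    (∀ t, Real.sqrt ((n t).1 ^ 2 + (n t).2 ^ 2) = 1) ∧
    (∀ t, deriv x t * (n t).1 + deriv y t * (n t).2 = 0) := by
  have hηs : ContDiff ℝ (⊤ : ℕ∞) η := contDiff_top_of_eq_integral (contDiff_const.mul hh) hη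
  have hFi : ContDiff ℝ (⊤ : ℕ∞) fun u => l u * sin (η u) := hl.mul hηs.sin
  have hGi : ContDiff ℝ (⊤ : ℕ∞) fun u => l u * cos (η u) := hl.mul hηs.cos
  have hFs := contDiff_top_of_eq_integral hFi hF
  have hGs := contDiff_top_of_eq_integral hGi hG
  have hFd := hasDerivAt_of_eq_integral hFi.continuous hF
  have hGd := hasDerivAt_of_eq_integral hGi.continuous hG
  have hys : ContDiff ℝ (⊤ : ℕ∞) y := by
    rw [funext hy]
    exact (((hFs.sub contDiff_const).pow 2).add ((hGs.sub contDiff_const).pow 2)).sqrt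
      fun t => (hpos t).ne'
  have hypos : ∀ t, 0 < y t := fun t => by
    rw [hy]
    exact Real.sqrt_pos.2 (hpos t)
  have hysq : ∀ t, y t ^ 2 = (F t - c₁) ^ 2 + (G t - c₂) ^ 2 := fun t => by
    rw [hy, Real.sq_sqrt (hpos t).le]
  have hn' : ∀ t, n t =
      ((-(F t - c₁) * sin (η t) - (G t - c₂) * cos (η t)) / y t,
        (-(F t - c₁) * cos (η t) + (G t - c₂) * sin (η t)) / y t) := fun t => by
    have hθ : -(η t) + Real.pi / 2 = Real.pi / 2 - η t := by ring
    rw [hn, hU, hθ]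
    simp only [rot, Real.cos_pi_div_two_sub, Real.sin_pi_div_two_sub, neg_sq, ← hy,
      Prod.smul_mk, smul_eq_mul, Prod.mk.injEq]
    constructor <;> ring
  refine ⟨?_, fun t => ?_, fun t => ?_⟩
  · rw [funext hn']
    have hf := hFs.sub (contDiff_const (c := c₁))
    have hg := hGs.sub (contDiff_const (c := c₂))
    exact (((hf.neg.mul hηs.sin).sub (hg.mul hηs.cos)).div hys fun t => (hypos t).ne').prodMk
      (((hf.neg.mul hηs.cos).add (hg.mul hηs.sin)).div hys fun t => (hypos t).ne')
  · have hy0 := (hypos t).ne'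
    rw [hn', Real.sqrt_eq_one]
    field_simp
    rw [hysq]
    linear_combination ((F t - c₁) ^ 2 + (G t - c₂) ^ 2) * Real.sin_sq_add_cos_sq (η t)
  · have hy0 := (hypos t).ne'
    have hxi : Continuous fun u =>
        (deriv F u * (G u - c₂) - deriv G u * (F u - c₁)) / y u := by
      simp only [fun u => (hFd u).deriv, fun u => (hGd u).deriv]
      exact ((hFi.continuous.mul (hGs.continuous.sub continuous_const)).sub
        (hGi.continuous.mul (hFs.continuous.sub continuous_const))).div hys.continuous
        fun u => (hypos u).ne'
    have hyd : HasDerivAt y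
        (((F t - c₁) * (l t * sin (η t)) + (G t - c₂) * (l t * cos (η t))) / y t) t := by
      have hd := ((((hFd t).sub_const c₁).fun_pow 2).fun_add
        (((hGd t).sub_const c₂).fun_pow 2)).sqrt (hpos t).ne'
      rw [← funext hy, ← hy] at hd
      convert hd using 1
      field_simp
      push_cast
      ring
    rw [(hasDerivAt_of_eq_integral hxi hx t).deriv, hyd.deriv, (hFd t).deriv, (hGd t).deriv, hn']
    field_simp
    ring
end

section
/- Suppose l(p) = 0. Then γ'(p) = 0, and det(γ''(p), γ'''(p)) ≠ 0 if and only if l'(p)·η'(p) ≠ 0. (By the cusp criterion, this says γ has a 3/2-cusp at p if and only if l'(p)·η'(p) ≠ 0.) -/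
open Real

open scoped ContDiff

theorem hasDerivAt_of_eq_intervalIntegral {f F : ℝ → ℝ} (hf : Continuous f)
    (hF : ∀ t, F t = ∫ u in (0 : ℝ)..t, f u) (t : ℝ) : HasDerivAt F (f t) t := by
  rw [funext hF]
  exact intervalIntegral.integral_hasDerivAt_right (hf.intervalIntegrable _ _)
    (hf.stronglyMeasurableAtFilter _ _) hf.continuousAt

theorem contDiff_infty_of_hasDerivAt {f F : ℝ → ℝ} (hf : ContDiff ℝ ∞ f)
    (hF : ∀ t, HasDerivAt F (f t) t) : ContDiff ℝ ∞ F := by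
  rw [contDiff_infty_iff_deriv]
  exact ⟨fun t => (hF t).differentiableAt, by rwa [funext fun t => (hF t).deriv]⟩

/-- If `γ' = l e` and `l p = 0`, then `det (γ'' p) (γ''' p) = 2 (l' p)² det (e p) (e' p)`. -/
theorem det2_iteratedDeriv_of_deriv_eq_smul {l : ℝ → ℝ} {e γ : ℝ → ℝ × ℝ}
    (hl : ContDiff ℝ ∞ l) (he : ContDiff ℝ ∞ e) (hγ : ∀ t, HasDerivAt γ (l t • e t) t)
    {p : ℝ} (hp : l p = 0) :
    det2 (iteratedDeriv 2 γ p) (iteratedDeriv 3 γ p) =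
      2 * deriv l p ^ 2 * det2 (e p) (deriv e p) := by
  have hl' := (contDiff_infty_iff_deriv.1 hl).2
  have he' := (contDiff_infty_iff_deriv.1 he).2
  have dl : Differentiable ℝ l := (contDiff_infty_iff_deriv.1 hl).1
  have de : Differentiable ℝ e := (contDiff_infty_iff_deriv.1 he).1
  have dl' : Differentiable ℝ (deriv l) := (contDiff_infty_iff_deriv.1 hl').1
  have de' : Differentiable ℝ (deriv e) := (contDiff_infty_iff_deriv.1 he').1
  have h1 : deriv γ = fun t => l t • e t := funext fun t => (hγ t).deriv
  have h2 : iteratedDeriv 2 γ = fun t => l t • deriv e t + deriv l t • e t := by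
    rw [iteratedDeriv_succ, iteratedDeriv_one, h1]
    exact funext fun t => ((dl t).hasDerivAt.smul (de t).hasDerivAt).deriv
  have h3 : iteratedDeriv 3 γ p = (l p • deriv (deriv e) p + deriv l p • deriv e p) +
      (deriv l p • deriv e p + deriv (deriv l) p • e p) := by
    rw [iteratedDeriv_succ, h2]
    exact (((dl p).hasDerivAt.smul (de' p).hasDerivAt).add
      ((dl' p).hasDerivAt.smul (de p).hasDerivAt)).deriv
  rw [h3, h2]
  simp only [det2, hp, Prod.fst_add, Prod.snd_add, Prod.smul_fst, Prod.smul_snd, smul_eq_mul]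
  ring

/-- Criterion for a 3/2-cusp of `γ` at a singular point `p`:
`det(γ''(p), γ'''(p)) ≠ 0` iff `l'(p) η'(p) ≠ 0`. -/
theorem cusp_32_criterion
    (l h : ℝ → ℝ) (hl : ContDiff ℝ (⊤ : ℕ∞) l) (hh : ContDiff ℝ (⊤ : ℕ∞) h)
    (η F G : ℝ → ℝ)
    (hη : ∀ u, η u = ∫ v in (0:ℝ)..u, 2 * h v)
    (hF : ∀ t, F t = ∫ u in (0:ℝ)..t, l u * sin (η u))
    (hG : ∀ t, G t = ∫ u in (0:ℝ)..t, l u * cos (η u))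
    (c₁ c₂ : ℝ)
    (hpos : ∀ t, 0 < (F t - c₁) ^ 2 + (G t - c₂) ^ 2)
    (y x : ℝ → ℝ)
    (hy : ∀ t, y t = Real.sqrt ((F t - c₁) ^ 2 + (G t - c₂) ^ 2))
    (hx : ∀ t, x t = ∫ u in (0:ℝ)..t,
      (deriv F u * (G u - c₂) - deriv G u * (F u - c₁)) / y u)
    (γ : ℝ → ℝ × ℝ) (hγ : ∀ t, γ t = (x t, y t))
    (U : ℝ → ℝ × ℝ) (hU : ∀ t, U t = (-(F t - c₁), G t - c₂))
    (p : ℝ) (hlp : l p = 0) :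
    deriv γ p = 0 ∧
    (det2 (iteratedDeriv 2 γ p) (iteratedDeriv 3 γ p) ≠ 0 ↔
      deriv l p * deriv η p ≠ 0) := by
  have hη' : ∀ t, HasDerivAt η (2 * h t) t :=
    hasDerivAt_of_eq_intervalIntegral (continuous_const.mul hh.continuous) hη
  have cη : ContDiff ℝ ∞ η := contDiff_infty_of_hasDerivAt (contDiff_const.mul hh) hη'
  have clsin : ContDiff ℝ ∞ fun t => l t * sin (η t) := hl.mul cη.sin
  have clcos : ContDiff ℝ ∞ fun t => l t * cos (η t) := hl.mul cη.cos
  have hF' := hasDerivAt_of_eq_intervalIntegral clsin.continuous hF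
  have hG' := hasDerivAt_of_eq_intervalIntegral clcos.continuous hG
  have cF : ContDiff ℝ ∞ fun t => F t - c₁ :=
    (contDiff_infty_of_hasDerivAt clsin hF').sub contDiff_const
  have cG : ContDiff ℝ ∞ fun t => G t - c₂ :=
    (contDiff_infty_of_hasDerivAt clcos hG').sub contDiff_const
  have ypos : ∀ t, 0 < y t := fun t => by rw [hy]; exact Real.sqrt_pos.2 (hpos t)
  have ysq : ∀ t, y t ^ 2 = (F t - c₁) ^ 2 + (G t - c₂) ^ 2 := fun t => by
    rw [hy, Real.sq_sqrt (hpos t).le]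
  have cy : ContDiff ℝ ∞ y := by
    rw [funext hy]
    exact ((cF.pow 2).add (cG.pow 2)).sqrt fun t => (hpos t).ne'
  set A : ℝ → ℝ := fun t => sin (η t) * (G t - c₂) - cos (η t) * (F t - c₁) with hA
  set B : ℝ → ℝ := fun t => sin (η t) * (F t - c₁) + cos (η t) * (G t - c₂) with hB
  have hAB : ∀ t, A t ^ 2 + B t ^ 2 = y t ^ 2 := fun t => by
    rw [ysq]
    simp only [hA, hB]
    linear_combination ((F t - c₁) ^ 2 + (G t - c₂) ^ 2) * sin_sq_add_cos_sq (η t)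
  have hy' : ∀ t, HasDerivAt y (l t * (B t / y t)) t := fun t => by
    have := ((((hF' t).sub_const c₁).pow 2).add (((hG' t).sub_const c₂).pow 2)).sqrt (hpos t).ne'
    convert this using 1
    · exact funext hy
    · have h0 := (ypos t).ne'
      simp only [Pi.add_apply, Pi.pow_apply]
      rw [← hy]
      simp only [hB]
      field_simp
      ring
  set e : ℝ → ℝ × ℝ := fun t => (A t / y t, B t / y t) with he
  have cA : ContDiff ℝ ∞ A := (cη.sin.mul cG).sub (cη.cos.mul cF)
  have cB : ContDiff ℝ ∞ B := (cη.sin.mul cF).add (cη.cos.mul cG)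
  have y0 : ∀ t, y t ≠ 0 := fun t => (ypos t).ne'
  have ce : ContDiff ℝ ∞ e := (cA.div cy y0).prodMk (cB.div cy y0)
  have hx' : ∀ t, HasDerivAt x (l t * (A t / y t)) t := by
    apply hasDerivAt_of_eq_intervalIntegral (f := fun t => l t * (A t / y t))
      (hl.mul (cA.div cy y0)).continuous
    intro t
    rw [hx]
    congr 1
    funext u
    rw [(hF' u).deriv, (hG' u).deriv]
    simp only [hA]
    ring
  have hγ' : ∀ t, HasDerivAt γ (l t • e t) t := fun t => by
    rw [funext hγ]
    exact (hx' t).prodMk (hy' t)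
  refine ⟨by rw [(hγ' p).deriv, hlp, zero_smul], ?_⟩
  have hyp : HasDerivAt y 0 p := by simpa [hlp] using hy' p
  have hFp : HasDerivAt (fun t => F t - c₁) 0 p := by simpa [hlp] using (hF' p).sub_const c₁
  have hGp : HasDerivAt (fun t => G t - c₂) 0 p := by simpa [hlp] using (hG' p).sub_const c₂
  have hAp : HasDerivAt A (2 * h p * B p) p := by
    refine (((hη' p).sin.mul hGp).sub ((hη' p).cos.mul hFp)).congr_deriv ?_
    simp only [hB]
    ring
  have hBp : HasDerivAt B (-(2 * h p * A p)) p := by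
    refine (((hη' p).sin.mul hFp).add ((hη' p).cos.mul hGp)).congr_deriv ?_
    simp only [hA]
    ring
  have hep : det2 (e p) (deriv e p) = -(2 * h p) := by
    have he' : HasDerivAt e _ p := (hAp.div hyp (y0 p)).prodMk (hBp.div hyp (y0 p))
    rw [he'.deriv]
    simp only [det2, he]
    have h0 := y0 p
    field_simp
    linear_combination -h p * 2 * y p * hAB p
  rw [det2_iteratedDeriv_of_deriv_eq_smul hl ce hγ' hlp, hep, (hη' p).deriv]
  simp
end

section
/- Suppose l and h are periodic with period L > 0, l(0) ≠ 0, and cos η(L) = 1 (i.e. 1 − cos η(L) = 0). If y(L) = y(0), y'(L) = y'(0) and x'(L) = x'(0), then F(L) = 0 and G(L) = 0, i.e. ∫₀ᴸ l(u) sin η(u) du = ∫₀ᴸ l(u) cos η(u) du = 0. -/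
open Real

/-- The fundamental theorem of calculus for a continuous integrand. -/
theorem hasDerivAt_primitive {f : ℝ → ℝ} (hf : Continuous f) (a t : ℝ) :
    HasDerivAt (fun s => ∫ u in a..s, f u) (f t) t :=
  intervalIntegral.integral_hasDerivAt_right (hf.intervalIntegrable a t)
    hf.aestronglyMeasurable.stronglyMeasurableAtFilter hf.continuousAt

/-- Necessity of `F(L) = G(L) = 0` for periodicity in the degenerate case
`cos η(L) = 1`. -/
theorem necessity_of_vanishing_integrals_degenerate_case
    (l h : ℝ → ℝ) (hl : ContDiff ℝ (⊤ : ℕ∞) l) (hh : ContDiff ℝ (⊤ : ℕ∞) h)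
    (η F G : ℝ → ℝ)
    (hη : ∀ u, η u = ∫ v in (0:ℝ)..u, 2 * h v)
    (hF : ∀ t, F t = ∫ u in (0:ℝ)..t, l u * sin (η u))
    (hG : ∀ t, G t = ∫ u in (0:ℝ)..t, l u * cos (η u))
    (c₁ c₂ : ℝ)
    (hpos : ∀ t, 0 < (F t - c₁) ^ 2 + (G t - c₂) ^ 2)
    (y x : ℝ → ℝ)
    (hy : ∀ t, y t = Real.sqrt ((F t - c₁) ^ 2 + (G t - c₂) ^ 2))
    (hx : ∀ t, x t = ∫ u in (0:ℝ)..t,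
      (deriv F u * (G u - c₂) - deriv G u * (F u - c₁)) / y u)
    (L : ℝ) (hL : 0 < L)
    (hlper : ∀ t, l (t + L) = l t) (hhper : ∀ t, h (t + L) = h t)
    (hl0 : l 0 ≠ 0)
    (hcos : cos (η L) = 1)
    (hyL : y L = y 0) (hy'L : deriv y L = deriv y 0) (hx'L : deriv x L = deriv x 0) :
    F L = 0 ∧ G L = 0 := by
  have hlc : Continuous l := hl.continuous
  have hhc : Continuous h := hh.continuous
  have hηc : Continuous η := by
    rw [funext hη]
    exact intervalIntegral.continuous_primitive
      (fun a b => (continuous_const.mul hhc).intervalIntegrable a b) 0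
  have hF' : ∀ t, HasDerivAt F (l t * sin (η t)) t := by
    intro t
    rw [funext hF]
    exact hasDerivAt_primitive (by fun_prop) 0 t
  have hG' : ∀ t, HasDerivAt G (l t * cos (η t)) t := by
    intro t
    rw [funext hG]
    exact hasDerivAt_primitive (by fun_prop) 0 t
  have hFc : Continuous F := continuous_iff_continuousAt.2 fun t => (hF' t).continuousAt
  have hGc : Continuous G := continuous_iff_continuousAt.2 fun t => (hG' t).continuousAt
  have hypos : ∀ t, 0 < y t := fun t => by
    rw [hy]
    exact Real.sqrt_pos.2 (hpos t)
  have hyc : Continuous y := by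
    rw [funext hy]
    fun_prop
  have hx' : ∀ t, deriv x t =
      (l t * sin (η t) * (G t - c₂) - l t * cos (η t) * (F t - c₁)) / y t := by
    intro t
    rw [funext hx]
    simp only [fun u => (hF' u).deriv, fun u => (hG' u).deriv]
    refine (hasDerivAt_primitive (Continuous.div ?_ hyc fun u => (hypos u).ne') 0 t).deriv
    fun_prop
  have hy' : ∀ t, deriv y t =
      (l t * sin (η t) * (F t - c₁) + l t * cos (η t) * (G t - c₂)) / y t := by
    intro t
    have hd := ((((hF' t).sub_const c₁).fun_pow 2).fun_add
      (((hG' t).sub_const c₂).fun_pow 2)).sqrt (hpos t).ne'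
    rw [← funext hy, ← hy t] at hd
    rw [hd.deriv]
    have hyt := (hypos t).ne'
    rw [div_eq_div_iff (mul_ne_zero two_ne_zero hyt) hyt]
    push_cast
    ring
  have hη0 : η 0 = 0 := by simp [hη]
  have hF0 : F 0 = 0 := by simp [hF]
  have hG0 : G 0 = 0 := by simp [hG]
  have hlL : l L = l 0 := by simpa using hlper 0
  have hsin : sin (η L) = 0 := Real.sin_eq_zero_iff_cos_eq.2 (Or.inl hcos)
  have hy0 := (hypos 0).ne'
  rw [hy', hy', hyL, hη0, hsin, hcos, hlL, sin_zero, cos_zero, hF0, hG0,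
    div_left_inj' hy0] at hy'L
  rw [hx', hx', hyL, hη0, hsin, hcos, hlL, sin_zero, cos_zero, hF0, hG0,
    div_left_inj' hy0] at hx'L
  constructor
  · apply mul_left_cancel₀ hl0
    linarith
  · apply mul_left_cancel₀ hl0
    linarith
end
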